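/- Let α > 0 and λ = λ₁ + iλ₂ with λ₂ ≥ α|λ₁|/(2√(α+1)), and let u be a Schwartz-class classical solution of equation (1.1) on [0,∞) with initial datum u₀. Then there exists a constant C > 0, depending only on c₂, such that for all t ≥ 1, sup_{x∈ℝ} |u(t,x)| ≤ C ( ‖u₀‖_{L²(ℝ)} + ‖x u₀‖_{L²(ℝ)} ) t^{−1/2}. -/

import Mathlib

open MeasureTheory Real Set

noncomputable section

/-- A Schwartz-class classical solution of equation (1.1),
`−i ∂_t u + c₂ ∂_x² u + i c₁ ∂_x u − c₀ u = λ |u|^α u`, on `[0,∞) × ℝ`. -/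
structure SchwartzSolution (c₂ c₁ c₀ α : ℝ) (lam : ℂ) (u : ℝ → ℝ → ℂ) where
  ut : ℝ → ℝ → ℂ
  ux : ℝ → ℝ → ℂ
  uxx : ℝ → ℝ → ℂ
  hut : ∀ x : ℝ, ∀ t ∈ Ici (0:ℝ), HasDerivWithinAt (fun s => u s x) (ut t x) (Ici 0) t
  hux : ∀ t ∈ Ici (0:ℝ), ∀ x : ℝ, HasDerivAt (fun y => u t y) (ux t x) x
  huxx : ∀ t ∈ Ici (0:ℝ), ∀ x : ℝ, HasDerivAt (fun y => ux t y) (uxx t x) x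
  hu_cont : ContinuousOn (fun p : ℝ × ℝ => u p.1 p.2) (Ici 0 ×ˢ univ)
  hut_cont : ContinuousOn (fun p : ℝ × ℝ => ut p.1 p.2) (Ici 0 ×ˢ univ)
  hux_cont : ContinuousOn (fun p : ℝ × ℝ => ux p.1 p.2) (Ici 0 ×ˢ univ)
  huxx_cont : ContinuousOn (fun p : ℝ × ℝ => uxx p.1 p.2) (Ici 0 ×ˢ univ)
  hdecay : ∀ n : ℕ, ∀ T : ℝ, 0 < T → ∃ C : ℝ, ∀ t ∈ Icc (0:ℝ) T, ∀ x : ℝ,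
    (‖u t x‖ + ‖ut t x‖ + ‖ux t x‖ + ‖uxx t x‖) * (1 + |x|) ^ n ≤ C
  heq : ∀ t : ℝ, 0 < t → ∀ x : ℝ,
    -Complex.I * ut t x + (c₂ : ℂ) * uxx t x + Complex.I * (c₁ : ℂ) * ux t x
      - (c₀ : ℂ) * u t x = lam * Complex.ofReal (‖u t x‖ ^ α) * u t x


/-- The scalar form of the Liskevich–Perelmuter inequality. -/
theorem mul_rpow_sub_rpow_le {α r ρ : ℝ} (hα : 0 < α) (hρ : 0 ≤ ρ) (h : ρ ≤ r) :
    (α + 2) * (r * ρ * (r ^ α - ρ ^ α)) ≤ α * (r ^ α * r ^ 2 - ρ ^ α * ρ ^ 2) := by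
  have young : ∀ x : ℝ, 0 < x →
      0 ≤ α * x ^ (α + 1) - (α + 1) * x ^ α * ρ + ρ ^ (α + 1) := by
    intro x hx
    have h1 : 0 < α + 1 := by linarith
    have key := Real.geom_mean_le_arith_mean2_weighted (w₁ := α / (α + 1)) (w₂ := 1 / (α + 1))
      (p₁ := x ^ (α + 1)) (p₂ := ρ ^ (α + 1)) (by positivity) (by positivity) (by positivity)
      (by positivity) (by field_simp)
    rw [← Real.rpow_mul hx.le, ← Real.rpow_mul hρ, mul_div_cancel₀ _ h1.ne',
      mul_div_cancel₀ _ h1.ne', Real.rpow_one] at key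
    have := mul_le_mul_of_nonneg_left key h1.le
    field_simp at this
    linarith
  let g : ℝ → ℝ := fun x =>
    α * (x ^ (α + 2) - ρ ^ (α + 2)) - (α + 2) * (ρ * x ^ (α + 1) - x * ρ ^ (α + 1))
  have hg : ∀ x, HasDerivAt g
      (α * ((α + 2) * x ^ (α + 1)) - (α + 2) * (ρ * ((α + 1) * x ^ α) - ρ ^ (α + 1))) x := by
    intro x
    have d₁ : HasDerivAt (fun x : ℝ => x ^ (α + 2)) ((α + 2) * x ^ (α + 1)) x := by
      have := Real.hasDerivAt_rpow_const (x := x) (p := α + 2) (Or.inr (by linarith))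
      rwa [show α + 2 - 1 = α + 1 by ring] at this
    have d₂ : HasDerivAt (fun x : ℝ => x ^ (α + 1)) ((α + 1) * x ^ α) x := by
      have := Real.hasDerivAt_rpow_const (x := x) (p := α + 1) (Or.inr (by linarith))
      rwa [show α + 1 - 1 = α by ring] at this
    have := ((d₁.sub_const (ρ ^ (α + 2))).const_mul α).sub
      (((d₂.const_mul ρ).sub ((hasDerivAt_id' x).mul_const (ρ ^ (α + 1)))).const_mul (α + 2))
    rwa [one_mul] at this
  have mono : MonotoneOn g (Ici 0) := by
    refine monotoneOn_of_deriv_nonneg (convex_Ici 0)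
      (fun x _ => (hg x).continuousAt.continuousWithinAt)
      (fun x _ => (hg x).differentiableAt.differentiableWithinAt) fun x hx => ?_
    rw [interior_Ici] at hx
    rw [(hg x).deriv]
    nlinarith [mul_nonneg (show 0 ≤ α + 2 by linarith) (young x hx)]
  have hpow : ∀ x : ℝ, 0 ≤ x → x ^ (α + 2) = x ^ α * x ^ 2 ∧ x ^ (α + 1) = x ^ α * x := by
    intro x hx
    refine ⟨?_, ?_⟩
    · rw [Real.rpow_add_of_nonneg hx hα.le (by norm_num)]; norm_cast
    · rw [Real.rpow_add_of_nonneg hx hα.le (by norm_num), Real.rpow_one]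
  have hr := hρ.trans h
  have := mono hρ hr h
  simp only [g, (hpow r hr).1, (hpow r hr).2, (hpow ρ hρ).1, (hpow ρ hρ).2] at this
  nlinarith [this]

/-- The squared form of `mul_rpow_sub_rpow_le`, symmetric in `r` and `ρ`. -/
theorem sq_mul_rpow_sub_rpow_le {α r ρ : ℝ} (hα : 0 < α) (hr : 0 ≤ r) (hρ : 0 ≤ ρ) :
    4 * (α + 1) * (r * ρ * (r ^ α - ρ ^ α)) ^ 2 ≤
      α ^ 2 * ((r ^ α * r ^ 2 + ρ ^ α * ρ ^ 2) ^ 2 - ((r ^ α + ρ ^ α) * (r * ρ)) ^ 2) := by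
  wlog h : ρ ≤ r generalizing r ρ
  · have := this hρ hr (le_of_not_ge h)
    convert this using 1 <;> ring
  have h1 := mul_rpow_sub_rpow_le hα hρ h
  have h2 : 0 ≤ (α + 2) * (r * ρ * (r ^ α - ρ ^ α)) := by
    have := sub_nonneg.2 (Real.rpow_le_rpow hρ h hα.le)
    positivity
  have h3 := pow_le_pow_left₀ h2 h1 2
  nlinarith [h3]

/-- The Liskevich–Perelmuter inequality: under the large-dissipation condition, multiplication of
the power nonlinearity by `i λ` is dissipative. -/
theorem re_I_mul_sub_power_mul_conj_nonpos {α : ℝ} (hα : 0 < α) {lam : ℂ}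
    (hlam : α * |lam.re| / (2 * √(α + 1)) ≤ lam.im) (a b : ℂ) :
    (Complex.I * (lam * Complex.ofReal (‖a‖ ^ α) * a - lam * Complex.ofReal (‖b‖ ^ α) * b)
      * (starRingEnd ℂ) (a - b)).re ≤ 0 := by
  have hkey := sq_mul_rpow_sub_rpow_le hα (norm_nonneg a) (norm_nonneg b)
  have hR : 0 ≤ ‖a‖ ^ α := by positivity
  have hS : 0 ≤ ‖b‖ ^ α := by positivity
  set R := ‖a‖ ^ α
  set S := ‖b‖ ^ α
  have ha : ‖a‖ ^ 2 = a.re ^ 2 + a.im ^ 2 := by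
    rw [← Complex.normSq_eq_norm_sq, Complex.normSq_apply]; ring
  have hb : ‖b‖ ^ 2 = b.re ^ 2 + b.im ^ 2 := by
    rw [← Complex.normSq_eq_norm_sq, Complex.normSq_apply]; ring
  set p := a.re * b.re + a.im * b.im with hp
  set q := a.im * b.re - a.re * b.im with hq
  have hpq : p ^ 2 + q ^ 2 = (‖a‖ * ‖b‖) ^ 2 := by
    rw [mul_pow, ha, hb, hp, hq]; ring
  set M := R * ‖a‖ ^ 2 + S * ‖b‖ ^ 2 with hM
  have hM0 : 0 ≤ M := by positivity
  set s := √(α + 1) with hs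
  have hs0 : 0 < s := Real.sqrt_pos.2 (by linarith)
  have hs2 : s ^ 2 = α + 1 := Real.sq_sqrt (by linarith)
  have him : 2 * s * (|R - S| * |q|) ≤ α * (M - (R + S) * p) := by
    have hsq : (α * (R + S) * p + 2 * s * (|R - S| * |q|)) ^ 2 ≤ (α * M) ^ 2 := by
      have h1 : (α * (R + S) * p + 2 * s * (|R - S| * |q|)) ^ 2 ≤
          ((α * (R + S)) ^ 2 + (2 * s * |R - S|) ^ 2) * (p ^ 2 + |q| ^ 2) := by
        nlinarith [sq_nonneg (α * (R + S) * |q| - 2 * s * |R - S| * p)]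
      rw [sq_abs q, hpq, mul_pow (2 * s), sq_abs, mul_pow 2 s, hs2] at h1
      nlinarith [h1, hkey]
    have := abs_le_of_sq_le_sq' hsq (by positivity)
    linarith [this.2]
  have hre : (Complex.I * (lam * Complex.ofReal R * a - lam * Complex.ofReal S * b)
      * (starRingEnd ℂ) (a - b)).re =
      -(lam.im * (M - (R + S) * p)) + lam.re * ((R - S) * q) := by
    rw [hM, ha, hb, hp, hq]
    simp
    ring
  rw [hre]
  have hlam' : α * |lam.re| ≤ lam.im * (2 * s) := (div_le_iff₀ (by positivity)).1 hlam
  have hZ : 0 ≤ M - (R + S) * p := by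
    have : 0 ≤ α * (M - (R + S) * p) := le_trans (by positivity) him
    exact nonneg_of_mul_nonneg_right this hα
  have h1 : lam.re * ((R - S) * q) ≤ |lam.re| * (|R - S| * |q|) := by
    rw [← abs_mul, ← abs_mul]; exact le_abs_self _
  have h2 := mul_le_mul_of_nonneg_left him (abs_nonneg lam.re)
  have h3 := mul_le_mul_of_nonneg_right hlam' hZ
  have h4 : 2 * s * (|lam.re| * (|R - S| * |q|)) ≤ 2 * s * (lam.im * (M - (R + S) * p)) := by
    linarith
  have h5 := le_of_mul_le_mul_left h4 (by positivity)
  linarith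

/-- A classical solution with the regularity and decay needed for the `L²` contraction estimate;
the equation and the differentiability are only required at positive times. -/
structure IsDecayingSolution (c₂ c₁ c₀ α : ℝ) (lam : ℂ) (u ut ux uxx : ℝ → ℝ → ℂ) : Prop where
  hasDerivAt_time : ∀ t, 0 < t → ∀ x, HasDerivAt (fun s => u s x) (ut t x) t
  hasDerivAt_space : ∀ t, 0 < t → ∀ x, HasDerivAt (u t) (ux t x) x
  hasDerivAt_space_space : ∀ t, 0 < t → ∀ x, HasDerivAt (ux t) (uxx t x) x
  continuousOn_time : ∀ x, ContinuousOn (fun s => u s x) (Ici 0)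
  continuous_space : ∀ t, 0 ≤ t → Continuous (u t)
  continuous_ut : ∀ t, 0 < t → Continuous (ut t)
  decay : ∀ T, 0 < T → ∃ C, ∀ t ∈ Icc 0 T, ∀ x,
    ‖u t x‖ + ‖ut t x‖ + ‖ux t x‖ + ‖uxx t x‖ ≤ C * (1 + x ^ 2)⁻¹
  equation : ∀ t, 0 < t → ∀ x, ut t x = -Complex.I * c₂ * uxx t x + c₁ * ux t x
    + Complex.I * c₀ * u t x + Complex.I * (lam * Complex.ofReal (‖u t x‖ ^ α) * u t x)

theorem inv_one_add_sq_le_one (x : ℝ) : (1 + x ^ 2)⁻¹ ≤ 1 :=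
  inv_le_one_of_one_le₀ (by nlinarith [sq_nonneg x])

theorem mul_le_sq_mul_inv_one_add_sq {a b C x : ℝ} (hb : 0 ≤ b)
    (ha' : a ≤ C * (1 + x ^ 2)⁻¹) (hb' : b ≤ C * (1 + x ^ 2)⁻¹) :
    a * b ≤ C ^ 2 * (1 + x ^ 2)⁻¹ := by
  have hw : 0 < (1 + x ^ 2)⁻¹ := by positivity
  calc a * b ≤ C * (1 + x ^ 2)⁻¹ * (C * (1 + x ^ 2)⁻¹) :=
        mul_le_mul ha' hb' hb (hb.trans hb')
    _ = C ^ 2 * (1 + x ^ 2)⁻¹ * (1 + x ^ 2)⁻¹ := by ring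
    _ ≤ C ^ 2 * (1 + x ^ 2)⁻¹ * 1 := by
        gcongr
        exact inv_one_add_sq_le_one x
    _ = C ^ 2 * (1 + x ^ 2)⁻¹ := mul_one _

theorem integrable_of_continuous_of_le {f : ℝ → ℝ} (hf : Continuous f) {K : ℝ}
    (h : ∀ x, ‖f x‖ ≤ K * (1 + x ^ 2)⁻¹) : Integrable f :=
  (integrable_inv_one_add_sq.const_mul K).mono' hf.aestronglyMeasurable (.of_forall h)

/-- The `L²` distance of two decaying solutions does not increase. -/
theorem IsDecayingSolution.integral_norm_sub_sq_le {c₂ c₁ c₀ α : ℝ} {lam : ℂ} (hα : 0 < α)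
    (hlam : α * |lam.re| / (2 * √(α + 1)) ≤ lam.im) {u ut ux uxx v vt vx vxx : ℝ → ℝ → ℂ}
    (hu : IsDecayingSolution c₂ c₁ c₀ α lam u ut ux uxx)
    (hv : IsDecayingSolution c₂ c₁ c₀ α lam v vt vx vxx) {t : ℝ} (ht : 0 ≤ t) :
    ∫ x, ‖u t x - v t x‖ ^ 2 ≤ ∫ x, ‖u 0 x - v 0 x‖ ^ 2 := by
  have bound : ∀ T, 0 < T → ∃ C, ∀ t ∈ Icc 0 T, ∀ x,
      ‖u t x - v t x‖ ≤ C * (1 + x ^ 2)⁻¹ ∧ ‖ut t x - vt t x‖ ≤ C * (1 + x ^ 2)⁻¹ ∧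
      ‖ux t x - vx t x‖ ≤ C * (1 + x ^ 2)⁻¹ ∧ ‖uxx t x - vxx t x‖ ≤ C * (1 + x ^ 2)⁻¹ := by
    intro T hT
    obtain ⟨A, hA⟩ := hu.decay T hT
    obtain ⟨B, hB⟩ := hv.decay T hT
    refine ⟨A + B, fun t ht x => ?_⟩
    have h1 := hA t ht x
    have h2 := hB t ht x
    rw [add_mul]
    refine ⟨(norm_sub_le _ _).trans ?_, (norm_sub_le _ _).trans ?_, (norm_sub_le _ _).trans ?_,
      (norm_sub_le _ _).trans ?_⟩ <;>
    linarith [norm_nonneg (u t x), norm_nonneg (ut t x), norm_nonneg (ux t x),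
      norm_nonneg (uxx t x), norm_nonneg (v t x), norm_nonneg (vt t x), norm_nonneg (vx t x),
      norm_nonneg (vxx t x)]
  have hcont : ∀ t, 0 ≤ t → Continuous fun x => u t x - v t x := fun t ht =>
    (hu.continuous_space t ht).sub (hv.continuous_space t ht)
  have hderiv : ∀ t, 0 < t → ∃ D, HasDerivAt (fun s => ∫ x, ‖u s x - v s x‖ ^ 2) D t ∧ D ≤ 0 := by
    intro t ht
    obtain ⟨C, hC⟩ := bound (t + 1) (by linarith)
    obtain ⟨hint, hd⟩ := hasDerivAt_integral_of_dominated_loc_of_deriv_le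
      (μ := volume) (x₀ := t) (s := Ioo 0 (t + 1)) (Ioo_mem_nhds ht (by linarith))
      (F := fun s x => ‖u s x - v s x‖ ^ 2)
      (F' := fun s x => 2 * inner ℝ (u s x - v s x) (ut s x - vt s x))
      (bound := fun x => 2 * (C ^ 2 * (1 + x ^ 2)⁻¹))
      (by
        filter_upwards [Ioi_mem_nhds ht] with s hs
        exact ((hcont s (le_of_lt hs)).norm.pow 2).aestronglyMeasurable)
      (by
        refine integrable_of_continuous_of_le ((hcont t ht.le).norm.pow 2) (K := C ^ 2) fun x => ?_
        have := (hC t ⟨ht.le, by linarith⟩ x).1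
        rw [norm_pow, norm_norm, sq]
        exact mul_le_sq_mul_inv_one_add_sq (norm_nonneg _) this this)
      (by
        refine Continuous.aestronglyMeasurable ?_
        exact continuous_const.mul ((hcont t ht.le).inner
          ((hu.continuous_ut t ht).sub (hv.continuous_ut t ht))))
      (by
        refine .of_forall fun x s hs => ?_
        obtain ⟨h0, h1, -, -⟩ := hC s ⟨hs.1.le, hs.2.le⟩ x
        rw [norm_mul, Real.norm_ofNat]
        gcongr
        exact (norm_inner_le_norm _ _).trans (mul_le_sq_mul_inv_one_add_sq (norm_nonneg _) h0 h1))
      ((integrable_inv_one_add_sq.const_mul _).const_mul _)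
      (by
        refine .of_forall fun x s hs => ?_
        exact ((hu.hasDerivAt_time s hs.1 x).sub (hv.hasDerivAt_time s hs.1 x)).norm_sq)
    refine ⟨_, hd, ?_⟩
    have htC := fun x => hC t ⟨ht.le, by linarith⟩ x
    have d₁ : ∀ x, HasDerivAt (fun x => u t x - v t x) (ux t x - vx t x) x := fun x =>
      (hu.hasDerivAt_space t ht x).sub (hv.hasDerivAt_space t ht x)
    have d₂ : ∀ x, HasDerivAt (fun x => -Complex.I * c₂ * (ux t x - vx t x))
        (-Complex.I * c₂ * (uxx t x - vxx t x)) x := fun x =>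
      ((hu.hasDerivAt_space_space t ht x).sub (hv.hasDerivAt_space_space t ht x)).const_mul _
    let g : ℝ → ℝ := fun x => 2 * inner ℝ (u t x - v t x) (-Complex.I * c₂ * (ux t x - vx t x))
      + c₁ * ‖u t x - v t x‖ ^ 2
    let g' : ℝ → ℝ := fun x =>
      2 * inner ℝ (u t x - v t x) (-Complex.I * c₂ * (uxx t x - vxx t x))
        + c₁ * (2 * inner ℝ (u t x - v t x) (ux t x - vx t x))
    have hg : ∀ x, HasDerivAt g (g' x) x := by
      intro x
      have h0 : inner ℝ (ux t x - vx t x) (-Complex.I * c₂ * (ux t x - vx t x)) = 0 := by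
        simp [Complex.inner]
        ring
      have := (((d₁ x).inner ℝ (d₂ x)).const_mul 2).add ((d₁ x).norm_sq.const_mul c₁)
      rwa [h0, add_zero] at this
    have hn : ∀ z : ℂ, ‖-Complex.I * c₂ * z‖ = |c₂| * ‖z‖ := fun z => by simp
    have hgb : ∀ x, ‖g x‖ ≤ (2 * |c₂| + |c₁|) * C ^ 2 * (1 + x ^ 2)⁻¹ := by
      intro x
      obtain ⟨h0, -, h1, -⟩ := htC x
      have e1 := mul_le_sq_mul_inv_one_add_sq (norm_nonneg _) h0 h1
      have e2 := mul_le_sq_mul_inv_one_add_sq (norm_nonneg _) h0 h0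
      calc ‖g x‖ ≤ 2 * (‖u t x - v t x‖ * (|c₂| * ‖ux t x - vx t x‖))
            + |c₁| * ‖u t x - v t x‖ ^ 2 := by
            refine (norm_add_le _ _).trans (add_le_add ?_ ?_)
            · rw [norm_mul, Real.norm_ofNat, ← hn]
              gcongr
              exact norm_inner_le_norm _ _
            · simp
        _ ≤ _ := by
            nlinarith [mul_le_mul_of_nonneg_left e1 (abs_nonneg c₂),
              mul_le_mul_of_nonneg_left e2 (abs_nonneg c₁)]
    have hgb' : ∀ x, ‖g' x‖ ≤ (2 * |c₂| + 2 * |c₁|) * C ^ 2 * (1 + x ^ 2)⁻¹ := by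
      intro x
      obtain ⟨h0, -, h1, h2⟩ := htC x
      have e1 := mul_le_sq_mul_inv_one_add_sq (norm_nonneg _) h0 h1
      have e2 := mul_le_sq_mul_inv_one_add_sq (norm_nonneg _) h0 h2
      calc ‖g' x‖ ≤ 2 * (‖u t x - v t x‖ * (|c₂| * ‖uxx t x - vxx t x‖))
            + |c₁| * (2 * (‖u t x - v t x‖ * ‖ux t x - vx t x‖)) := by
            refine (norm_add_le _ _).trans (add_le_add ?_ ?_)
            · rw [norm_mul, Real.norm_ofNat, ← hn]
              gcongr
              exact norm_inner_le_norm _ _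
            · rw [norm_mul, norm_mul, Real.norm_ofNat, Real.norm_eq_abs]
              gcongr
              exact norm_inner_le_norm _ _
        _ ≤ _ := by
            nlinarith [mul_le_mul_of_nonneg_left e1 (abs_nonneg c₁),
              mul_le_mul_of_nonneg_left e2 (abs_nonneg c₂)]
    have hgi : Integrable g := integrable_of_continuous_of_le
      (continuous_iff_continuousAt.2 fun x => (hg x).continuousAt) hgb
    have hgi' : Integrable g' := by
      refine (integrable_inv_one_add_sq.const_mul _).mono' ?_ (.of_forall hgb')
      rw [← funext fun x => (hg x).deriv]
      exact (stronglyMeasurable_deriv g).aestronglyMeasurable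
    refine (integral_mono hint hgi' fun x => ?_).trans
      (integral_eq_zero_of_hasDerivAt_of_integrable hg hgi' hgi).le
    have hneg := re_I_mul_sub_power_mul_conj_nonpos hα hlam (u t x) (v t x)
    have hsplit : inner ℝ (u t x - v t x) (ut t x - vt t x) =
        inner ℝ (u t x - v t x) (-Complex.I * c₂ * (uxx t x - vxx t x))
        + c₁ * inner ℝ (u t x - v t x) (ux t x - vx t x)
        + (Complex.I * (lam * Complex.ofReal (‖u t x‖ ^ α) * u t x
          - lam * Complex.ofReal (‖v t x‖ ^ α) * v t x)
          * (starRingEnd ℂ) (u t x - v t x)).re := by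
      rw [hu.equation t ht x, hv.equation t ht x]
      generalize lam * Complex.ofReal (‖u t x‖ ^ α) * u t x = N₁
      generalize lam * Complex.ofReal (‖v t x‖ ^ α) * v t x = N₂
      simp [Complex.inner]
      ring
    simp only [g', hsplit]
    linarith
  choose! D hD using hderiv
  have hanti : AntitoneOn (fun s => ∫ x, ‖u s x - v s x‖ ^ 2) (Icc 0 (t + 1)) := by
    obtain ⟨C, hC⟩ := bound (t + 1) (by linarith)
    refine antitoneOn_of_deriv_nonpos (convex_Icc _ _) ?_ ?_ ?_
    · refine continuousOn_of_dominated (bound := fun x => C ^ 2 * (1 + x ^ 2)⁻¹) ?_ ?_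
        (integrable_inv_one_add_sq.const_mul _) ?_
      · exact fun s hs => ((hcont s hs.1).norm.pow 2).aestronglyMeasurable
      · refine fun s hs => .of_forall fun x => ?_
        have := (hC s hs x).1
        rw [norm_pow, norm_norm, sq]
        exact mul_le_sq_mul_inv_one_add_sq (norm_nonneg _) this this
      · exact .of_forall fun x => ((((hu.continuousOn_time x).sub
          (hv.continuousOn_time x)).norm.pow 2).mono Icc_subset_Ici_self)
    · intro s hs
      rw [interior_Icc] at hs
      exact (hD s hs.1).1.differentiableAt.differentiableWithinAt
    · intro s hs
      rw [interior_Icc] at hs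
      rw [(hD s hs.1).1.deriv]
      exact (hD s hs.1).2
  exact hanti ⟨le_rfl, by linarith⟩ ⟨ht, by linarith⟩ ht

/-- Galilean boost of a function of time and space, adapted to the symbol `c₂ ξ² + c₁ ξ`. -/
def galileanBoost (c₂ c₁ : ℝ) (u : ℝ → ℝ → ℂ) (s : ℝ) : ℝ → ℝ → ℂ := fun t x =>
  Complex.exp (Complex.I * ((s * x + (c₂ * s ^ 2 + c₁ * s) * t : ℝ) : ℂ)) * u t (x + 2 * c₂ * s * t)

theorem galileanBoost_zero (c₂ c₁ : ℝ) (u : ℝ → ℝ → ℂ) : galileanBoost c₂ c₁ u 0 = u := by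
  funext t x
  simp [galileanBoost]

theorem norm_exp_I_mul_ofReal_eq_one (θ : ℝ) : ‖Complex.exp (Complex.I * (θ : ℂ))‖ = 1 := by
  rw [mul_comm, Complex.norm_exp_ofReal_mul_I]

theorem hasDerivAt_exp_I_mul_ofReal {f : ℝ → ℝ} {f' x : ℝ} (hf : HasDerivAt f f' x) :
    HasDerivAt (fun y => Complex.exp (Complex.I * (f y : ℂ)))
      (Complex.exp (Complex.I * (f x : ℂ)) * (Complex.I * f')) x :=
  (hf.ofReal_comp.const_mul Complex.I).cexp

section

variable {c₂ c₁ c₀ α : ℝ} {lam : ℂ} {u : ℝ → ℝ → ℂ}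

theorem SchwartzSolution.continuous_of_continuousOn {f : ℝ → ℝ → ℂ}
    (hf : ContinuousOn (fun p : ℝ × ℝ => f p.1 p.2) (Ici 0 ×ˢ univ)) {t : ℝ} (ht : 0 ≤ t) :
    Continuous (f t) :=
  hf.comp_continuous (f := fun x : ℝ => (t, x)) (by fun_prop) fun _ => ⟨ht, mem_univ _⟩

/-- The derivative of a Schwartz-class solution along a straight line in space-time. -/
theorem SchwartzSolution.hasDerivAt_along_line (S : SchwartzSolution c₂ c₁ c₀ α lam u)
    {t : ℝ} (ht : 0 < t) (x κ : ℝ) :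
    HasDerivAt (fun s => u s (x + κ * s))
      (S.ut t (x + κ * t) + κ * S.ux t (x + κ * t)) t := by
  have hmem : ∀ y : ℝ, (Ici (0 : ℝ) ×ˢ (univ : Set ℝ)) ∈ nhds (t, y) := fun y =>
    prod_mem_nhds (Ici_mem_nhds ht) Filter.univ_mem
  have hpos : ∀ᶠ p : ℝ × ℝ in nhds (t, x + κ * t), 0 < p.1 :=
    continuous_fst.continuousAt.eventually (Ioi_mem_nhds ht)
  have hF := hasStrictFDerivAt_uncurry_coprod (𝕜 := ℝ) (u := (t, x + κ * t)) (f := u)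
    (f₁ := fun t x => ContinuousLinearMap.toSpanSingleton ℝ (S.ut t x))
    (f₂ := fun t x => ContinuousLinearMap.toSpanSingleton ℝ (S.ux t x))
    (by
      filter_upwards [hpos] with p hp
      exact ((S.hut p.2 p.1 hp.le).hasDerivAt (Ici_mem_nhds hp)).hasFDerivAt)
    (by
      filter_upwards [hpos] with p hp
      exact (S.hux p.1 hp.le p.2).hasFDerivAt)
    ((ContinuousLinearMap.toSpanSingletonCLE (𝕜 := ℝ) (E := ℂ)).continuous.continuousAt.comp
      (S.hut_cont.continuousAt (hmem _)))
    ((ContinuousLinearMap.toSpanSingletonCLE (𝕜 := ℝ) (E := ℂ)).continuous.continuousAt.comp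
      (S.hux_cont.continuousAt (hmem _)))
  have hline : HasDerivAt (fun s : ℝ => (s, x + κ * s)) ((1 : ℝ), κ) t := by
    have := (hasDerivAt_id' t).prodMk (((hasDerivAt_id' t).const_mul κ).const_add x)
    rwa [mul_one] at this
  have := hF.hasFDerivAt.comp_hasDerivAt t hline
  refine this.congr_deriv ?_
  simp [Function.HasUncurry.uncurry]

/-- Galilean boosts of Schwartz-class solutions solve the same equation. -/
theorem SchwartzSolution.exists_isDecayingSolution_galileanBoost
    (S : SchwartzSolution c₂ c₁ c₀ α lam u) (s : ℝ) :
    ∃ ut ux uxx, IsDecayingSolution c₂ c₁ c₀ α lam (galileanBoost c₂ c₁ u s) ut ux uxx := by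
  set ω : ℝ := c₂ * s ^ 2 + c₁ * s with hω
  set κ : ℝ := 2 * c₂ * s with hκ
  let E : ℝ → ℝ → ℂ := fun t x => Complex.exp (Complex.I * ((s * x + ω * t : ℝ) : ℂ))
  have hE : ∀ t x, ‖E t x‖ = 1 := fun t x => norm_exp_I_mul_ofReal_eq_one _
  have hEt : ∀ t x, HasDerivAt (fun t => E t x) (E t x * (Complex.I * ω)) t := fun t x => by
    refine hasDerivAt_exp_I_mul_ofReal ?_
    simpa using ((hasDerivAt_id' t).const_mul ω).const_add (s * x)
  have hEx : ∀ t x, HasDerivAt (E t) (E t x * (Complex.I * s)) x := fun t x => by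
    refine hasDerivAt_exp_I_mul_ofReal ?_
    simpa using ((hasDerivAt_id' x).const_mul s).add_const (ω * t)
  have hEc : ∀ t, Continuous (E t) := fun t =>
    continuous_iff_continuousAt.2 fun x => (hEx t x).continuousAt
  have hshift : ∀ t, Continuous fun x => x + κ * t := fun t => by fun_prop
  have hux : ∀ t, 0 < t → ∀ x, HasDerivAt (fun x => u t (x + κ * t)) (S.ux t (x + κ * t)) x :=
    fun t ht x => (S.hux t ht.le (x + κ * t)).comp_add_const x (κ * t)
  have huxx : ∀ t, 0 < t → ∀ x, HasDerivAt (fun x => S.ux t (x + κ * t))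
      (S.uxx t (x + κ * t)) x :=
    fun t ht x => (S.huxx t ht.le (x + κ * t)).comp_add_const x (κ * t)
  refine ⟨fun t x => E t x * (Complex.I * ω * u t (x + κ * t) + S.ut t (x + κ * t)
      + κ * S.ux t (x + κ * t)),
    fun t x => E t x * (Complex.I * s * u t (x + κ * t) + S.ux t (x + κ * t)),
    fun t x => E t x * (-(s ^ 2 : ℝ) * u t (x + κ * t) + 2 * Complex.I * s * S.ux t (x + κ * t)
      + S.uxx t (x + κ * t)), ?_, ?_, ?_, ?_, ?_, ?_, ?_, ?_⟩
  · intro t ht x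
    exact ((hEt t x).mul (S.hasDerivAt_along_line ht x κ)).congr_deriv (by ring)
  · intro t ht x
    exact ((hEx t x).mul (hux t ht x)).congr_deriv (by ring)
  · intro t ht x
    refine ((hEx t x).mul (((hux t ht x).const_mul (Complex.I * s)).add
      (huxx t ht x))).congr_deriv ?_
    simp only [Pi.add_apply]
    push_cast
    linear_combination (E t x * (s : ℂ) ^ 2 * u t (x + κ * t)) * Complex.I_sq
  · intro x
    refine ContinuousOn.mul (fun t _ => (hEt t x).continuousAt.continuousWithinAt) ?_
    exact S.hu_cont.comp (f := fun t : ℝ => (t, x + κ * t)) (by fun_prop)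
      fun t ht => ⟨ht, mem_univ _⟩
  · intro t ht
    exact (hEc t).mul ((continuous_of_continuousOn S.hu_cont ht).comp (hshift t))
  · intro t ht
    have h0 := (continuous_of_continuousOn S.hu_cont ht.le).comp (hshift t)
    have h1 := (continuous_of_continuousOn S.hut_cont ht.le).comp (hshift t)
    have h2 := (continuous_of_continuousOn S.hux_cont ht.le).comp (hshift t)
    exact (hEc t).mul (((continuous_const.mul h0).add h1).add (continuous_const.mul h2))
  · intro T hT
    obtain ⟨C, hC⟩ := S.hdecay 2 T hT
    refine ⟨(2 + |ω| + |κ| + 3 * |s| + s ^ 2) * ((1 + |κ| * T) ^ 2 * C), fun t ht x => ?_⟩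
    have hCx := hC t ht (x + κ * t)
    have hw : (1 + x ^ 2) ≤ (1 + |κ| * T) ^ 2 * (1 + |x + κ * t|) ^ 2 := by
      have hκt : |κ * t| ≤ |κ| * T := by
        rw [abs_mul, abs_of_nonneg ht.1]
        exact mul_le_mul_of_nonneg_left ht.2 (abs_nonneg _)
      have hx : |x| ≤ |x + κ * t| + |κ| * T := by
        have := abs_sub (x + κ * t) (κ * t)
        rw [add_sub_cancel_right] at this
        linarith
      have h1 : 1 + |x| ≤ (1 + |κ| * T) * (1 + |x + κ * t|) := by
        have : 0 ≤ |κ| * T * |x + κ * t| := by positivity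
        nlinarith
      rw [← mul_pow]
      calc 1 + x ^ 2 ≤ (1 + |x|) ^ 2 := by nlinarith [sq_abs x, abs_nonneg x]
        _ ≤ _ := pow_le_pow_left₀ (by positivity) h1 2
    rw [← div_eq_mul_inv, le_div_iff₀ (by positivity)]
    have n0 := norm_nonneg (u t (x + κ * t))
    have nt := norm_nonneg (S.ut t (x + κ * t))
    have n1 := norm_nonneg (S.ux t (x + κ * t))
    have n2 := norm_nonneg (S.uxx t (x + κ * t))
    have e0 : ‖galileanBoost c₂ c₁ u s t x‖ = ‖u t (x + κ * t)‖ := by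
      change ‖E t x * u t (x + κ * t)‖ = _
      rw [norm_mul, hE, one_mul]
    have et : ‖E t x * (Complex.I * ω * u t (x + κ * t) + S.ut t (x + κ * t)
        + κ * S.ux t (x + κ * t))‖ ≤ |ω| * ‖u t (x + κ * t)‖ + ‖S.ut t (x + κ * t)‖
        + |κ| * ‖S.ux t (x + κ * t)‖ := by
      rw [norm_mul, hE, one_mul]
      refine (norm_add₃_le).trans (le_of_eq ?_)
      simp
    have e1 : ‖E t x * (Complex.I * s * u t (x + κ * t) + S.ux t (x + κ * t))‖ ≤
        |s| * ‖u t (x + κ * t)‖ + ‖S.ux t (x + κ * t)‖ := by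
      rw [norm_mul, hE, one_mul]
      refine (norm_add_le _ _).trans (le_of_eq ?_)
      simp
    have e2 : ‖E t x * (-(s ^ 2 : ℝ) * u t (x + κ * t)
        + 2 * Complex.I * s * S.ux t (x + κ * t) + S.uxx t (x + κ * t))‖ ≤
        s ^ 2 * ‖u t (x + κ * t)‖ + 2 * |s| * ‖S.ux t (x + κ * t)‖ + ‖S.uxx t (x + κ * t)‖ := by
      rw [norm_mul, hE, one_mul]
      refine (norm_add₃_le).trans (le_of_eq ?_)
      simp
    rw [e0]
    set N := ‖u t (x + κ * t)‖ + ‖S.ut t (x + κ * t)‖ + ‖S.ux t (x + κ * t)‖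
      + ‖S.uxx t (x + κ * t)‖ with hN
    have hN0 : 0 ≤ N := by positivity
    have h0N : ‖u t (x + κ * t)‖ ≤ N := by linarith
    have h1N : ‖S.ux t (x + κ * t)‖ ≤ N := by linarith
    have p1 := mul_le_mul_of_nonneg_left h0N (abs_nonneg ω)
    have p2 := mul_le_mul_of_nonneg_left h1N (abs_nonneg κ)
    have p3 := mul_le_mul_of_nonneg_left h0N (abs_nonneg s)
    have p4 := mul_le_mul_of_nonneg_left h1N (abs_nonneg s)
    have p5 := mul_le_mul_of_nonneg_left h0N (sq_nonneg s)
    calc _ ≤ ((2 + |ω| + |κ| + 3 * |s| + s ^ 2) * N) *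
          ((1 + |κ| * T) ^ 2 * (1 + |x + κ * t|) ^ 2) := by
          refine mul_le_mul ?_ hw (by positivity) (by positivity)
          linarith
      _ = (2 + |ω| + |κ| + 3 * |s| + s ^ 2) *
          ((1 + |κ| * T) ^ 2 * (N * (1 + |x + κ * t|) ^ 2)) := by ring
      _ ≤ _ := by gcongr
  · intro t ht x
    have h := S.heq t ht (x + κ * t)
    have hnorm : ‖galileanBoost c₂ c₁ u s t x‖ = ‖u t (x + κ * t)‖ := by
      change ‖E t x * u t (x + κ * t)‖ = _
      rw [norm_mul, hE, one_mul]
    rw [hnorm]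
    change _ = -Complex.I * c₂ * _ + c₁ * _ + Complex.I * c₀ * (E t x * u t (x + κ * t))
      + Complex.I * (lam * _ * (E t x * u t (x + κ * t)))
    rw [hω, hκ] at *
    push_cast at *
    linear_combination (Complex.I * E t x) * h + E t x * (S.ut t (x + 2 * c₂ * s * t)
      + (2 * c₂ * s - c₁) * S.ux t (x + 2 * c₂ * s * t)) * Complex.I_sq

end

theorem isDecayingSolution_zero (c₂ c₁ c₀ α : ℝ) (lam : ℂ) :
    IsDecayingSolution c₂ c₁ c₀ α lam 0 0 0 0 where
  hasDerivAt_time _ _ _ := hasDerivAt_const _ _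
  hasDerivAt_space _ _ _ := hasDerivAt_const _ _
  hasDerivAt_space_space _ _ _ := hasDerivAt_const _ _
  continuousOn_time _ := continuousOn_const
  continuous_space _ _ := continuous_const
  continuous_ut _ _ := continuous_const
  decay _ _ := ⟨0, by simp⟩
  equation _ _ _ := by simp

/-- Fatou's lemma for Bochner integrals of nonnegative real functions. -/
theorem integral_le_of_tendsto_of_integral_le {X : Type*} [MeasurableSpace X] {μ : Measure X}
    {f : ℕ → X → ℝ} {g : X → ℝ} {B : ℝ} (hf : ∀ n, Integrable (f n) μ) (h0 : ∀ n x, 0 ≤ f n x)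
    (hB : ∀ n, ∫ x, f n x ∂μ ≤ B)
    (hlim : ∀ x, Filter.Tendsto (fun n => f n x) Filter.atTop (nhds (g x))) :
    ∫ x, g x ∂μ ≤ B := by
  have hg0 : ∀ x, 0 ≤ g x := fun x => ge_of_tendsto' (hlim x) fun n => h0 n x
  have hgm : AEStronglyMeasurable g μ := aestronglyMeasurable_of_tendsto_ae Filter.atTop
    (fun n => (hf n).aestronglyMeasurable) (.of_forall hlim)
  rw [integral_eq_lintegral_of_nonneg_ae (.of_forall hg0) hgm]
  refine ENNReal.toReal_le_of_le_ofReal ((integral_nonneg (h0 0)).trans (hB 0)) ?_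
  calc ∫⁻ x, ENNReal.ofReal (g x) ∂μ
      = ∫⁻ x, Filter.liminf (fun n => ENNReal.ofReal (f n x)) Filter.atTop ∂μ :=
        lintegral_congr fun x => ((ENNReal.continuous_ofReal.tendsto _).comp (hlim x)).liminf_eq.symm
    _ ≤ Filter.liminf (fun n => ∫⁻ x, ENNReal.ofReal (f n x) ∂μ) Filter.atTop :=
        lintegral_liminf_le' fun n => (hf n).aestronglyMeasurable.aemeasurable.ennreal_ofReal
    _ ≤ ENNReal.ofReal B := by
        refine Filter.liminf_le_of_le (by isBoundedDefault) fun b hb => ?_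
        obtain ⟨n, hn⟩ := hb.exists
        refine hn.trans ?_
        rw [← ofReal_integral_eq_lintegral_ofReal (hf n) (.of_forall (h0 n))]
        exact ENNReal.ofReal_le_ofReal (hB n)

section

variable {c₂ c₁ c₀ α : ℝ} {lam : ℂ} {u : ℝ → ℝ → ℂ}

/-- The image of a solution under the generator of Galilean boosts, up to a factor `i`. -/
def SchwartzSolution.galileanField (S : SchwartzSolution c₂ c₁ c₀ α lam u) (t x : ℝ) : ℂ :=
  Complex.I * ((x + c₁ * t : ℝ) : ℂ) * u t x + ((2 * c₂ * t : ℝ) : ℂ) * S.ux t x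

theorem SchwartzSolution.integrable_norm_sq (S : SchwartzSolution c₂ c₁ c₀ α lam u)
    {t : ℝ} (ht : 0 ≤ t) {f : ℝ → ℂ} (hf : Continuous f) {K : ℝ}
    (h : ∀ x, ‖f x‖ ≤ K * (1 + |x|) * (‖u t x‖ + ‖S.ux t x‖)) :
    Integrable fun x => ‖f x‖ ^ 2 := by
  obtain ⟨C, hC⟩ := S.hdecay 2 (t + 1) (by linarith)
  refine integrable_of_continuous_of_le (hf.norm.pow 2) (K := (|K| * C) ^ 2) fun x => ?_
  have hCx := hC t ⟨ht, by linarith⟩ x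
  have h1 : ‖f x‖ * (1 + |x|) ≤ |K| * C := by
    calc ‖f x‖ * (1 + |x|) ≤ |K| * (1 + |x|) * (‖u t x‖ + ‖S.ut t x‖ + ‖S.ux t x‖ + ‖S.uxx t x‖)
          * (1 + |x|) := by
          refine mul_le_mul_of_nonneg_right ((h x).trans ?_) (by positivity)
          refine mul_le_mul ?_ ?_ (by positivity) (by positivity)
          · exact mul_le_mul_of_nonneg_right (le_abs_self K) (by positivity)
          · linarith [norm_nonneg (S.ut t x), norm_nonneg (S.uxx t x)]
      _ = |K| * ((‖u t x‖ + ‖S.ut t x‖ + ‖S.ux t x‖ + ‖S.uxx t x‖) * (1 + |x|) ^ 2) := by ring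
      _ ≤ _ := by gcongr
  have h2 := pow_le_pow_left₀ (by positivity) h1 2
  rw [norm_pow, norm_norm, ← div_eq_mul_inv, le_div_iff₀ (by positivity)]
  refine le_trans ?_ h2
  rw [mul_pow]
  gcongr
  nlinarith [sq_abs x, abs_nonneg x]

theorem SchwartzSolution.continuous_galileanField (S : SchwartzSolution c₂ c₁ c₀ α lam u)
    {t : ℝ} (ht : 0 ≤ t) : Continuous (S.galileanField t) := by
  have h0 := continuous_of_continuousOn S.hu_cont ht
  have h1 := continuous_of_continuousOn S.hux_cont ht
  unfold galileanField
  fun_prop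

theorem SchwartzSolution.integrable_norm_galileanField_sq
    (S : SchwartzSolution c₂ c₁ c₀ α lam u) {t : ℝ} (ht : 0 ≤ t) :
    Integrable fun x => ‖S.galileanField t x‖ ^ 2 := by
  refine S.integrable_norm_sq ht (S.continuous_galileanField ht)
    (K := 1 + |c₁ * t| + |2 * c₂ * t|) fun x => ?_
  have n0 := norm_nonneg (u t x)
  have n1 := norm_nonneg (S.ux t x)
  have e : ‖S.galileanField t x‖ ≤ |x + c₁ * t| * ‖u t x‖ + |2 * c₂ * t| * ‖S.ux t x‖ := by
    refine (norm_add_le _ _).trans (le_of_eq ?_)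
    rw [norm_mul, norm_mul, norm_mul, Complex.norm_I, one_mul, Complex.norm_real,
      Complex.norm_real, Real.norm_eq_abs, Real.norm_eq_abs]
  refine e.trans ?_
  rw [mul_add]
  refine add_le_add ?_ ?_
  · refine mul_le_mul_of_nonneg_right ((abs_add_le _ _).trans ?_) n0
    have : 0 ≤ |c₁ * t| * |x| + |2 * c₂ * t| * |x| + |2 * c₂ * t| := by positivity
    nlinarith
  · refine mul_le_mul_of_nonneg_right ?_ n1
    have : 0 ≤ |c₁ * t| * |x| + |2 * c₂ * t| * |x| + |c₁ * t| + |x| := by positivity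
    nlinarith

theorem SchwartzSolution.hasDerivAt_galileanBoost (S : SchwartzSolution c₂ c₁ c₀ α lam u)
    {t : ℝ} (ht : 0 ≤ t) (x : ℝ) :
    HasDerivAt (fun s => galileanBoost c₂ c₁ u s t x) (S.galileanField t x) 0 := by
  have h1 : HasDerivAt (fun s : ℝ => s * x + (c₂ * s ^ 2 + c₁ * s) * t) (x + c₁ * t) 0 := by
    have := ((hasDerivAt_id' (0 : ℝ)).mul_const x).add
      (((((hasDerivAt_id' (0 : ℝ)).pow 2).const_mul c₂).add
        ((hasDerivAt_id' (0 : ℝ)).const_mul c₁)).mul_const t)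
    exact this.congr_deriv (by simp)
  have h2 : HasDerivAt (fun s : ℝ => x + 2 * c₂ * s * t) (2 * c₂ * t) 0 := by
    have := (((hasDerivAt_id' (0 : ℝ)).const_mul (2 * c₂)).mul_const t).const_add x
    exact this.congr_deriv (by simp)
  have h3 : HasDerivAt (u t) (S.ux t x) (x + 2 * c₂ * 0 * t) := by
    simpa using S.hux t ht x
  refine ((hasDerivAt_exp_I_mul_ofReal h1).mul (h3.scomp (0 : ℝ) h2)).congr_deriv ?_
  simp [SchwartzSolution.galileanField]

/-- The Galilean vector field applied to a solution is controlled by the first moment of the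
initial datum. -/
theorem SchwartzSolution.integral_norm_galileanField_sq_le (hα : 0 < α)
    (hlam : α * |lam.re| / (2 * √(α + 1)) ≤ lam.im)
    (S : SchwartzSolution c₂ c₁ c₀ α lam u) {t : ℝ} (ht : 0 ≤ t) :
    ∫ x, ‖S.galileanField t x‖ ^ 2 ≤ ∫ x : ℝ, ‖(x : ℂ) * u 0 x‖ ^ 2 := by
  have hu0 := continuous_of_continuousOn S.hu_cont le_rfl
  have hmoment : Integrable fun x : ℝ => ‖(x : ℂ) * u 0 x‖ ^ 2 := by
    refine S.integrable_norm_sq le_rfl (by fun_prop) (K := 1) fun x => ?_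
    rw [norm_mul, Complex.norm_real, Real.norm_eq_abs]
    nlinarith [norm_nonneg (u 0 x), norm_nonneg (S.ux 0 x), abs_nonneg x,
      mul_nonneg (abs_nonneg x) (norm_nonneg (S.ux 0 x))]
  obtain ⟨_, _, _, h₀⟩ := S.exists_isDecayingSolution_galileanBoost 0
  rw [galileanBoost_zero] at h₀
  have hseq := tendsto_one_div_add_atTop_nhds_zero_nat (𝕜 := ℝ)
  refine integral_le_of_tendsto_of_integral_le
    (f := fun n x => ‖(1 / ((n : ℝ) + 1))⁻¹ •
      (galileanBoost c₂ c₁ u (1 / ((n : ℝ) + 1)) t x - u t x)‖ ^ 2) ?_ ?_ ?_ ?_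
  · intro n
    obtain ⟨_, _, _, hs⟩ := S.exists_isDecayingSolution_galileanBoost (1 / ((n : ℝ) + 1))
    obtain ⟨A, hA⟩ := hs.decay (t + 1) (by linarith)
    obtain ⟨B, hB⟩ := h₀.decay (t + 1) (by linarith)
    simp only [norm_smul, mul_pow]
    refine Integrable.const_mul ?_ _
    refine integrable_of_continuous_of_le
      (((hs.continuous_space t ht).sub (h₀.continuous_space t ht)).norm.pow 2)
      (K := (A + B) ^ 2) fun x => ?_
    have h1 := hA t ⟨ht, by linarith⟩ x
    have h2 := hB t ⟨ht, by linarith⟩ x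
    have h3 : ‖galileanBoost c₂ c₁ u (1 / ((n : ℝ) + 1)) t x - u t x‖ ≤
        (A + B) * (1 + x ^ 2)⁻¹ := by
      refine (norm_sub_le _ _).trans ?_
      rw [add_mul]
      refine add_le_add (le_trans ?_ h1) (le_trans ?_ h2) <;>
      · rw [add_assoc, add_assoc]
        exact le_add_of_nonneg_right (by positivity)
    rw [norm_pow, norm_norm, sq]
    exact mul_le_sq_mul_inv_one_add_sq (norm_nonneg _) h3 h3
  · exact fun n x => by positivity
  · intro n
    obtain ⟨_, _, _, hs⟩ := S.exists_isDecayingSolution_galileanBoost (1 / ((n : ℝ) + 1))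
    have hpos : (0 : ℝ) < 1 / ((n : ℝ) + 1) := by positivity
    set s : ℝ := 1 / ((n : ℝ) + 1)
    have h1 := hs.integral_norm_sub_sq_le hα hlam h₀ ht
    have h2 : ∫ x, ‖galileanBoost c₂ c₁ u s 0 x - u 0 x‖ ^ 2 ≤
        ∫ x : ℝ, s ^ 2 * ‖(x : ℂ) * u 0 x‖ ^ 2 := by
      refine integral_mono_of_nonneg (.of_forall fun x => by positivity) (hmoment.const_mul _)
        (.of_forall fun x => ?_)
      have hb : galileanBoost c₂ c₁ u s 0 x - u 0 x =
          (Complex.exp (Complex.I * ((s * x : ℝ) : ℂ)) - 1) * u 0 x := by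
        simp [galileanBoost, sub_mul]
      have he := Real.norm_exp_I_mul_ofReal_sub_one_le (x := s * x)
      simp only [hb]
      rw [← mul_pow]
      refine pow_le_pow_left₀ (norm_nonneg _) ?_ 2
      rw [norm_mul, norm_mul, Complex.norm_real, ← mul_assoc]
      refine mul_le_mul_of_nonneg_right (he.trans (le_of_eq ?_)) (norm_nonneg _)
      rw [norm_mul, Real.norm_of_nonneg hpos.le]
    rw [integral_const_mul] at h2
    simp only [norm_smul, mul_pow]
    rw [integral_const_mul, norm_inv, Real.norm_of_nonneg hpos.le, inv_pow,
      inv_mul_le_iff₀ (by positivity)]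
    exact h1.trans h2
  · intro x
    refine Filter.Tendsto.pow (Filter.Tendsto.norm ?_) 2
    have hslope := (S.hasDerivAt_galileanBoost ht x).tendsto_slope_zero
    simp only [zero_add, galileanBoost_zero] at hslope
    refine hslope.comp (tendsto_nhdsWithin_iff.2 ⟨hseq, .of_forall fun n => ?_⟩)
    exact (show (0 : ℝ) < 1 / ((n : ℝ) + 1) by positivity).ne'

/-- Pointwise decay of a solution in terms of the mass and the first moment of the datum. -/
theorem SchwartzSolution.norm_sq_le (hc₂ : 0 < c₂) (hα : 0 < α)
    (hlam : α * |lam.re| / (2 * √(α + 1)) ≤ lam.im)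
    (S : SchwartzSolution c₂ c₁ c₀ α lam u) {t : ℝ} (ht : 0 < t) (x : ℝ) :
    ‖u t x‖ ^ 2 ≤ (2 * c₂ * t)⁻¹ *
      ((∫ y, ‖u 0 y‖ ^ 2) + ∫ y : ℝ, ‖(y : ℂ) * u 0 y‖ ^ 2) := by
  have hmass : ∫ y, ‖u t y‖ ^ 2 ≤ ∫ y, ‖u 0 y‖ ^ 2 := by
    obtain ⟨_, _, _, h₀⟩ := S.exists_isDecayingSolution_galileanBoost 0
    rw [galileanBoost_zero] at h₀
    simpa using
      h₀.integral_norm_sub_sq_le hα hlam (isDecayingSolution_zero c₂ c₁ c₀ α lam) ht.le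
  have hmoment := S.integral_norm_galileanField_sq_le hα hlam ht.le
  have hu := continuous_of_continuousOn S.hu_cont ht.le
  have hui : Integrable fun y => ‖u t y‖ ^ 2 := by
    refine S.integrable_norm_sq ht.le hu (K := 1) fun y => ?_
    nlinarith [norm_nonneg (u t y), norm_nonneg (S.ux t y), abs_nonneg y,
      mul_nonneg (abs_nonneg y) (norm_nonneg (S.ux t y)),
      mul_nonneg (abs_nonneg y) (norm_nonneg (u t y))]
  have hGi := S.integrable_norm_galileanField_sq ht.le
  let g : ℝ → ℝ := fun y => (2 * c₂ * t)⁻¹ * (‖u t y‖ ^ 2 + ‖S.galileanField t y‖ ^ 2)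
  have hgi : Integrable g := (hui.add hGi).const_mul _
  let h' : ℝ → ℝ := fun y => 2 * inner ℝ (u t y) (S.ux t y)
  have hh : ∀ y, HasDerivAt (fun y => ‖u t y‖ ^ 2) (h' y) y := fun y => (S.hux t ht.le y).norm_sq
  have hle : ∀ y, ‖h' y‖ ≤ g y := by
    intro y
    have e : h' y = (2 * c₂ * t)⁻¹ * (2 * inner ℝ (u t y) (S.galileanField t y)) := by
      simp only [h']
      rw [eq_inv_mul_iff_mul_eq₀ (by positivity)]
      simp [SchwartzSolution.galileanField, Complex.inner]
      ring
    rw [e, norm_mul, Real.norm_of_nonneg (by positivity), norm_mul, Real.norm_ofNat]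
    refine mul_le_mul_of_nonneg_left ?_ (by positivity)
    nlinarith [norm_inner_le_norm (𝕜 := ℝ) (u t y) (S.galileanField t y),
      sq_nonneg (‖u t y‖ - ‖S.galileanField t y‖)]
  have hhi : Integrable h' := hgi.mono'
    (continuous_const.mul
      (hu.inner (continuous_of_continuousOn S.hux_cont ht.le))).aestronglyMeasurable
    (.of_forall hle)
  have hlim := tendsto_zero_of_hasDerivAt_of_integrableOn_Iic (a := x) (fun y _ => hh y)
    hhi.integrableOn hui.integrableOn
  have hint := integral_Iic_of_hasDerivAt_of_tendsto' (a := x) (fun y _ => hh y)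
    hhi.integrableOn hlim
  rw [sub_zero] at hint
  calc ‖u t x‖ ^ 2 = ∫ y in Iic x, h' y := hint.symm
    _ ≤ ∫ y in Iic x, g y := setIntegral_mono hhi.integrableOn hgi.integrableOn
        fun y => (le_abs_self _).trans (hle y)
    _ ≤ ∫ y, g y := setIntegral_le_integral hgi (.of_forall fun y => by positivity)
    _ = (2 * c₂ * t)⁻¹ * ((∫ y, ‖u t y‖ ^ 2) + ∫ y, ‖S.galileanField t y‖ ^ 2) := by
        rw [integral_const_mul, integral_add hui hGi]
    _ ≤ _ := by gcongr

end

/-- Under the large-dissipation condition `λ₂ ≥ α|λ₁|/(2√(α+1))`,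
there is a constant `C > 0` depending only on `c₂` such that
`sup_x |u(t,x)| ≤ C (‖u₀‖_{L²} + ‖x u₀‖_{L²}) t^{-1/2}` for all `t ≥ 1`. -/
theorem free_decay_rate (c₂ : ℝ) (hc₂ : 0 < c₂) :
    ∃ C : ℝ, 0 < C ∧ ∀ c₁ c₀ α : ℝ, 0 < α → ∀ lam : ℂ,
      α * |lam.re| / (2 * Real.sqrt (α + 1)) ≤ lam.im →
      ∀ u : ℝ → ℝ → ℂ, ∀ u₀ : ℝ → ℂ,
      SchwartzSolution c₂ c₁ c₀ α lam u →
      (∀ x : ℝ, u 0 x = u₀ x) →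
      ∀ t : ℝ, 1 ≤ t → ∀ x : ℝ,
        ‖u t x‖ ≤ C * (Real.sqrt (∫ y : ℝ, ‖u₀ y‖ ^ 2)
            + Real.sqrt (∫ y : ℝ, ‖(y : ℂ) * u₀ y‖ ^ 2)) * t ^ (-(1:ℝ)/2) := by
  refine ⟨(√c₂)⁻¹, by positivity, fun c₁ c₀ α hα lam hlam u u₀ S h0 t ht x => ?_⟩
  have ht0 : 0 < t := by linarith
  have h := S.norm_sq_le hc₂ hα hlam ht0 x
  simp only [h0] at h
  set A := ∫ y : ℝ, ‖u₀ y‖ ^ 2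
  set B := ∫ y : ℝ, ‖(y : ℂ) * u₀ y‖ ^ 2
  have hA0 : 0 ≤ A := integral_nonneg fun y => by positivity
  have hB0 : 0 ≤ B := integral_nonneg fun y => by positivity
  have htpow : t ^ (-(1:ℝ)/2) = (√t)⁻¹ := by
    rw [neg_div, Real.rpow_neg ht0.le, Real.sqrt_eq_rpow]
  rw [htpow]
  refine le_of_sq_le_sq ?_ (by positivity)
  rw [mul_pow, mul_pow, inv_pow, inv_pow, Real.sq_sqrt hc₂.le, Real.sq_sqrt ht0.le]
  have hAB : A + B ≤ 2 * (√A + √B) ^ 2 := by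
    nlinarith [Real.sq_sqrt hA0, Real.sq_sqrt hB0, Real.sqrt_nonneg A, Real.sqrt_nonneg B,
      mul_nonneg (Real.sqrt_nonneg A) (Real.sqrt_nonneg B)]
  calc ‖u t x‖ ^ 2 ≤ (2 * c₂ * t)⁻¹ * (A + B) := h
    _ ≤ (2 * c₂ * t)⁻¹ * (2 * (√A + √B) ^ 2) := by gcongr
    _ = c₂⁻¹ * (√A + √B) ^ 2 * t⁻¹ := by field_simp

end
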